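/- Let d be a positive natural number and let Φ be a linear map on M_d(ℂ) that is completely positive and trace preserving. Then there exist a natural number n with 1 ≤ n ≤ d², a unit vector Ω ∈ ℂ^n, and a unitary matrix U indexed by (Fin d × Fin n), such that for all X ∈ M_d(ℂ), Φ(X) = tr_R(U (X ⊗ |Ω⟩⟨Ω|) U†), where X ⊗ |Ω⟩⟨Ω| is the Kronecker product matrix with entries (X ⊗ |Ω⟩⟨Ω|)_{(i,k),(j,l)} = X_{ij} Ω_k conj(Ω_l). -/

import Mathlib

open Matrix
open scoped ComplexOrder

/-- The map `Φ ⊗ id_m` acting blockwise on matrices indexed by `Fin d × Fin m`. -/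
def blockMap {d : ℕ} (Φ : Matrix (Fin d) (Fin d) ℂ → Matrix (Fin d) (Fin d) ℂ) (m : ℕ)
    (A : Matrix (Fin d × Fin m) (Fin d × Fin m) ℂ) : Matrix (Fin d × Fin m) (Fin d × Fin m) ℂ :=
  Matrix.of fun p q => Φ (Matrix.of fun i j => A (i, p.2) (j, q.2)) p.1 q.1

/-- A map on `d × d` complex matrices is completely positive if `Φ ⊗ id_m` preserves
positive semidefiniteness for every `m ≥ 1`. -/
def IsCompletelyPositive {d : ℕ} (Φ : Matrix (Fin d) (Fin d) ℂ → Matrix (Fin d) (Fin d) ℂ) :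
    Prop :=
  ∀ m : ℕ, 1 ≤ m → ∀ A : Matrix (Fin d × Fin m) (Fin d × Fin m) ℂ,
    A.PosSemidef → (blockMap Φ m A).PosSemidef

/-- A map on `d × d` complex matrices is trace preserving if it preserves the trace. -/
def IsTracePreserving {d : ℕ} (Φ : Matrix (Fin d) (Fin d) ℂ → Matrix (Fin d) (Fin d) ℂ) :
    Prop :=
  ∀ X : Matrix (Fin d) (Fin d) ℂ, (Φ X).trace = X.trace

/-- The partial trace over the second (reservoir) factor. -/
noncomputable def ptraceR {d n : ℕ} (M : Matrix (Fin d × Fin n) (Fin d × Fin n) ℂ) :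
    Matrix (Fin d) (Fin d) ℂ :=
  Matrix.of fun i j => ∑ k : Fin n, M (i, k) (j, k)

/-- The Kronecker product `X ⊗ |Ω⟩⟨Ω|`. -/
def kronOmega {d n : ℕ} (X : Matrix (Fin d) (Fin d) ℂ) (Ω : Fin n → ℂ) :
    Matrix (Fin d × Fin n) (Fin d × Fin n) ℂ :=
  Matrix.of fun p q => X p.1 q.1 * Ω p.2 * star (Ω q.2)


/-- Kraus-type decomposition from the Choi matrix. -/
theorem choi_factor (d : ℕ) (hd : 0 < d)
    (Φ : Matrix (Fin d) (Fin d) ℂ →ₗ[ℂ] Matrix (Fin d) (Fin d) ℂ)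
    (hCP : IsCompletelyPositive (fun X => Φ X)) :
    ∃ B : Fin d → Fin d → Fin (d ^ 2) → ℂ, ∀ i j k l,
      Φ (Matrix.single k l 1) i j = ∑ a, B i k a * star (B j l a) := by
  have h := hCP d hd (vecMulVec (fun p : Fin d × Fin d => if p.1 = p.2 then (1:ℂ) else 0)
    (star (fun p : Fin d × Fin d => if p.1 = p.2 then (1:ℂ) else 0)))
    (posSemidef_vecMulVec_self_star _)
  obtain ⟨C, hC⟩ : ∃ C : Matrix (Fin d × Fin d) (Fin d × Fin d) ℂ, _ = Cᴴ * C := by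
    open scoped MatrixOrder in
    exact CStarAlgebra.nonneg_iff_eq_star_mul_self.mp h.nonneg
  have e : Fin (d ^ 2) ≃ Fin d × Fin d := 
    Fintype.equivOfCardEq (by simp [sq])
  refine ⟨fun i k a => star (C (e a) (i, k)), fun i j k l => ?_⟩
  have h2 := congrFun (congrFun hC (i, k)) (j, l)
  rw [Matrix.mul_apply, ← Equiv.sum_comp e] at h2
  simp only [star_star]
  simp only [conjTranspose_apply] at h2
  rw [← h2]
  simp only [blockMap, of_apply]
  refine congrFun (congrFun (congrArg Φ ?_) i) j
  ext a b
  simp only [single_apply, vecMulVec_apply, of_apply, Pi.star_apply]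
  by_cases h1 : a = k <;> by_cases h2 : b = l <;> simp [h1, h2, eq_comm (a := k), eq_comm (a := l)]

theorem dilation_of_CPTP (d : ℕ) (hd : 0 < d)
    (Φ : Matrix (Fin d) (Fin d) ℂ →ₗ[ℂ] Matrix (Fin d) (Fin d) ℂ)
    (hCP : IsCompletelyPositive (fun X => Φ X))
    (hTP : IsTracePreserving (fun X => Φ X)) :
    ∃ (n : ℕ) (_ : 1 ≤ n) (_ : n ≤ d ^ 2) (Ω : Fin n → ℂ) (_ : ∑ k, ‖Ω k‖ ^ 2 = 1)
      (U : Matrix (Fin d × Fin n) (Fin d × Fin n) ℂ)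
      (_ : U ∈ Matrix.unitaryGroup (Fin d × Fin n) ℂ),
      ∀ X, Φ X = ptraceR (U * kronOmega X Ω * Uᴴ) := by
  obtain ⟨B, hB⟩ := choi_factor d hd Φ hCP
  have hn : 1 ≤ d ^ 2 := Nat.one_le_pow _ _ hd
  let z : Fin (d ^ 2) := ⟨0, hn⟩
  let v : Fin d × Fin (d ^ 2) → EuclideanSpace ℂ (Fin d × Fin (d ^ 2)) :=
    fun p => WithLp.toLp 2 (fun q => B q.1 p.1 q.2)
  have hv : Orthonormal ℂ (({p | p.2 = z} : Set (Fin d × Fin (d ^ 2))).domRestrict v) := by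
    rw [orthonormal_iff_ite]
    rintro ⟨⟨k, a⟩, ha⟩ ⟨⟨l, b⟩, hb⟩
    simp only [Set.mem_ofPred_eq] at ha hb
    subst ha hb
    have h := hTP (Matrix.single l k 1)
    simp only [Matrix.trace, diag_apply, hB] at h
    simp only [Set.domRestrict_apply, v, PiLp.inner_apply, Fintype.sum_prod_type,
      RCLike.inner_apply]
    refine Eq.trans h ?_
    by_cases hkl : k = l
    · subst hkl; simp [single_apply]
    · have : l ≠ k := fun h => hkl h.symm
      simp only [single_apply, Subtype.mk.injEq, Prod.mk.injEq, hkl, false_and, if_false]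
      refine Finset.sum_eq_zero fun i _ => ?_
      rw [if_neg]
      rintro ⟨rfl, rfl⟩
      exact hkl rfl
  obtain ⟨b, hb⟩ := hv.exists_orthonormalBasis_extension_of_card_eq (by simp)
  have hU := (EuclideanSpace.basisFun (Fin d × Fin (d ^ 2)) ℂ).toMatrix_orthonormalBasis_mem_unitary b
  refine ⟨d ^ 2, hn, le_rfl, Pi.single z 1, ?_, _, hU, fun X => ?_⟩
  · rw [Finset.sum_eq_single z] <;> simp +contextual
  set U := (EuclideanSpace.basisFun (Fin d × Fin (d ^ 2)) ℂ).toBasis.toMatrix b with hUdef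
  have hUe : ∀ i a k, U (i, a) (k, z) = B i k a := by
    intro i a k
    simp [hUdef, Module.Basis.toMatrix_apply, hb (k, z) rfl, v]
  have hX : Φ X = ∑ k, ∑ l, X k l • Φ (Matrix.single k l 1) := by
    conv_lhs => rw [matrix_eq_sum_single X]
    simp only [map_sum, ← map_smul, smul_single, smul_eq_mul, mul_one]
  ext i j
  have key : ∀ a, (U * kronOmega X (Pi.single z 1) * Uᴴ) (i, a) (j, a)
      = ∑ k, ∑ l, X k l * (B i k a * star (B j l a)) := by
    intro a
    simp only [Matrix.mul_apply, Fintype.sum_prod_type, kronOmega, of_apply, Pi.single_apply,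
      conjTranspose_apply]
    rw [Finset.sum_comm, Finset.sum_eq_single z]
    · simp only [mul_ite, mul_one, mul_zero, if_true, star_one,
        Finset.sum_ite_eq', Finset.mem_univ, hUe, Finset.sum_mul]
      rw [Finset.sum_comm]
      refine Finset.sum_congr rfl fun k _ => Finset.sum_congr rfl fun l _ => by ring
    · intro y _ hy
      simp [hy]
    · simp
  simp only [ptraceR, of_apply, key, hX, Matrix.sum_apply, Matrix.smul_apply, hB, smul_eq_mul,
    Finset.mul_sum]
  symm
  rw [Finset.sum_comm]
  refine Finset.sum_congr rfl fun k _ => ?_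
  rw [Finset.sum_comm]
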